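/- arXiv:1402.3384 — 2 statements merged into one kernel-verified Lean document; each statement's English description precedes it below -/
import Mathlib

section
/- Under the mechanism E, the squared-error distortion of the proper companion estimator q̂_φ satisfies: for every database x ∈ D^n, E_{Y∼E(x)}[(q̂_φ(Y) − q_φ(x))²] ≤ 4(b−a)²(1+(2^l−1)e^{−ε})² / (c²(1−e^{−ε})²·n). -/
open Finset

abbrev Row (l : ℕ) := Fin l → Bool
abbrev Db (l n : ℕ) := Fin n → Row l

/-- Hamming distance on `D^n`. -/
def ham {l n : ℕ} (x y : Db l n) : ℕ :=
  (Finset.univ.filter fun i => x i ≠ y i).card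

/-- The pmf of the mechanism `E` on input `x`. -/
noncomputable def pE (l : ℕ) (ε : ℝ) {n : ℕ} (x y : Db l n) : ℝ :=
  Real.exp (-ε * (ham x y : ℝ)) / (1 + ((2:ℝ) ^ l - 1) * Real.exp (-ε)) ^ n

/-- `a_i = min_{v ∈ D} φ_i(v)`. -/
noncomputable def Amin {l n : ℕ} (φ : Fin n → Row l → ℝ) (i : Fin n) : ℝ :=
  Finset.univ.inf' Finset.univ_nonempty (φ i)

/-- `b_i = max_{v ∈ D} φ_i(v)`. -/
noncomputable def Bmax {l n : ℕ} (φ : Fin n → Row l → ℝ) (i : Fin n) : ℝ :=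
  Finset.univ.sup' Finset.univ_nonempty (φ i)

/-- The statistical query `q_φ(x) = (∑ i φ_i(x_i)) / (∑ i c_i)` with `c_i = b_i - a_i`. -/
noncomputable def qS {l n : ℕ} (φ : Fin n → Row l → ℝ) (x : Db l n) : ℝ :=
  (∑ i, φ i (x i)) / (∑ i, (Bmax φ i - Amin φ i))

/-- `C_φ = (∑ i ∑ v φ_i(v)) / (∑ i c_i)`. -/
noncomputable def Cphi {l n : ℕ} (φ : Fin n → Row l → ℝ) : ℝ :=
  (∑ i, ∑ v : Row l, φ i v) / (∑ i, (Bmax φ i - Amin φ i))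

/-- The unbiased companion estimator
`q̂ᵘ_φ(y) = (g(ε)/(1-e^{-ε})) q_φ(y) - (e^{-ε}/(1-e^{-ε})) C_φ` where `g(ε)=1+(2^l-1)e^{-ε}`. -/
noncomputable def qhatu {l n : ℕ} (ε : ℝ) (φ : Fin n → Row l → ℝ) (y : Db l n) : ℝ :=
  ((1 + ((2:ℝ) ^ l - 1) * Real.exp (-ε)) / (1 - Real.exp (-ε))) * qS φ y
    - (Real.exp (-ε) / (1 - Real.exp (-ε))) * Cphi φ

/-- For independent centered coordinates the second moment of the sum is the sum of the
second moments. -/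
theorem sum_prod_mul_sum_sq {ι α : Type*} [Fintype ι] [DecidableEq ι] [Fintype α]
    (p f : ι → α → ℝ) (hp : ∀ i, ∑ v, p i v = 1) (hf : ∀ i, ∑ v, p i v * f i v = 0) :
    ∑ y : ι → α, (∏ k, p k (y k)) * (∑ i, f i (y i)) ^ 2 = ∑ i, ∑ v, p i v * f i v ^ 2 := by
  have cross : ∀ i j, ∑ y : ι → α, (∏ k, p k (y k)) * (f i (y i) * f j (y j))
      = ∏ k, ∑ v, p k v * ((if k = i then f k v else 1) * (if k = j then f k v else 1)) := by
    intro i j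
    rw [Fintype.prod_sum]
    refine Finset.sum_congr rfl fun y _ => ?_
    rw [Finset.prod_mul_distrib, Finset.prod_mul_distrib]
    simp
  have offdiag : ∀ i j, j ≠ i → ∑ y : ι → α, (∏ k, p k (y k)) * (f i (y i) * f j (y j)) = 0 := by
    intro i j hij
    rw [cross]
    refine Finset.prod_eq_zero (Finset.mem_univ i) ?_
    simpa [hij.symm] using hf i
  have diag : ∀ i, ∑ y : ι → α, (∏ k, p k (y k)) * (f i (y i) * f i (y i))
      = ∑ v, p i v * f i v ^ 2 := by
    intro i
    rw [cross, Finset.prod_eq_single i]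
    · simp [sq]
    · intro k _ hk
      simpa [hk] using hp k
    · simp
  have expand : ∀ y : ι → α, (∏ k, p k (y k)) * (∑ i, f i (y i)) ^ 2
      = ∑ i, ∑ j, (∏ k, p k (y k)) * (f i (y i) * f j (y j)) := by
    intro y
    rw [sq, Finset.sum_mul_sum, Finset.mul_sum]
    exact Finset.sum_congr rfl fun i _ => Finset.mul_sum _ _ _
  simp_rw [expand]
  rw [Finset.sum_comm]
  refine Finset.sum_congr rfl fun i _ => ?_
  rw [Finset.sum_comm, Finset.sum_eq_single i (fun j _ hj => offdiag i j hj) (by simp), diag]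

/-- The output distribution of a single row of the mechanism `E`. -/
noncomputable def rowWeight (l : ℕ) (ε : ℝ) (u v : Row l) : ℝ :=
  (if u = v then 1 else Real.exp (-ε)) / (1 + ((2:ℝ) ^ l - 1) * Real.exp (-ε))

theorem normalizer_pos (l : ℕ) (ε : ℝ) : 0 < 1 + ((2:ℝ) ^ l - 1) * Real.exp (-ε) := by
  have h : (1:ℝ) ≤ 2 ^ l := one_le_pow₀ (by norm_num)
  have := mul_nonneg (sub_nonneg.2 h) (Real.exp_pos (-ε)).le
  linarith

theorem rowWeight_nonneg (l : ℕ) (ε : ℝ) (u v : Row l) : 0 ≤ rowWeight l ε u v := by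
  have := normalizer_pos l ε
  have := Real.exp_pos (-ε)
  unfold rowWeight
  split_ifs <;> positivity

theorem pE_eq_prod_rowWeight (l : ℕ) (ε : ℝ) {n : ℕ} (x y : Db l n) :
    pE l ε x y = ∏ i, rowWeight l ε (x i) (y i) := by
  unfold pE rowWeight ham
  rw [Finset.prod_div_distrib, Finset.prod_const, Finset.card_univ, Fintype.card_fin,
    Finset.prod_ite, Finset.prod_const_one, one_mul, Finset.prod_const, ← Real.exp_nat_mul,
    mul_comm]

theorem sum_rowWeight_mul (l : ℕ) (ε : ℝ) (u : Row l) (f : Row l → ℝ) :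
    ∑ v, rowWeight l ε u v * f v
      = ((1 - Real.exp (-ε)) * f u + Real.exp (-ε) * ∑ v, f v)
        / (1 + ((2:ℝ) ^ l - 1) * Real.exp (-ε)) := by
  have h : ∀ v, rowWeight l ε u v * f v
      = ((if u = v then (1 - Real.exp (-ε)) * f v else 0) + Real.exp (-ε) * f v)
        / (1 + ((2:ℝ) ^ l - 1) * Real.exp (-ε)) := by
    intro v
    unfold rowWeight
    split_ifs <;> ring
  simp_rw [h]
  rw [← Finset.sum_div, Finset.sum_add_distrib, ← Finset.mul_sum]
  simp

theorem sum_rowWeight (l : ℕ) (ε : ℝ) (u : Row l) : ∑ v, rowWeight l ε u v = 1 := by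
  have h := sum_rowWeight_mul l ε u fun _ => 1
  have hg := (normalizer_pos l ε).ne'
  simp only [mul_one] at h
  rw [h, div_eq_one_iff_eq hg]
  simp
  ring

/-- The distortion of the unbiased companion estimator. -/
theorem sum_pE_mul_qhatu_sub_sq_le {l n : ℕ} (hn : 1 ≤ n) {ε : ℝ} (hε : 0 < ε)
    (φ : Fin n → Row l → ℝ) {a b c : ℝ} (hc : 0 < c)
    (ha : ∀ i v, a ≤ φ i v) (hb : ∀ i v, φ i v ≤ b) (hφ : ∀ i, c ≤ Bmax φ i - Amin φ i)
    (x : Db l n) :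
    ∑ y : Db l n, pE l ε x y * (qhatu ε φ y - qS φ x) ^ 2
      ≤ (b - a) ^ 2 * (1 + ((2:ℝ) ^ l - 1) * Real.exp (-ε)) ^ 2
          / (c ^ 2 * (1 - Real.exp (-ε)) ^ 2 * n) := by
  have he : 0 < 1 - Real.exp (-ε) := sub_pos.2 (by simpa using hε)
  have hg := normalizer_pos l ε
  have hmean := sum_rowWeight_mul l ε
  have hw := sum_rowWeight l ε
  have hw0 := rowWeight_nonneg l ε
  have hn' : (0:ℝ) < n := by exact_mod_cast hn
  set e := Real.exp (-ε) with he_def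
  set g := 1 + ((2:ℝ) ^ l - 1) * e with hg_def
  set S := ∑ i, (Bmax φ i - Amin φ i) with hS_def
  have hS : n * c ≤ S := by
    simpa [hS_def] using Finset.card_nsmul_le_sum Finset.univ _ c fun i _ => hφ i
  have hS0 : 0 < S := lt_of_lt_of_le (by positivity) hS
  let m : Fin n → ℝ := fun i => ∑ v, rowWeight l ε (x i) v * φ i v
  have hma : ∀ i, a ≤ m i := fun i => by
    calc a = ∑ v, rowWeight l ε (x i) v * a := by rw [← Finset.sum_mul, hw, one_mul]
      _ ≤ m i := Finset.sum_le_sum fun v _ => mul_le_mul_of_nonneg_left (ha i v) (hw0 _ _)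
  have hmb : ∀ i, m i ≤ b := fun i => by
    calc m i ≤ ∑ v, rowWeight l ε (x i) v * b :=
          Finset.sum_le_sum fun v _ => mul_le_mul_of_nonneg_left (hb i v) (hw0 _ _)
      _ = b := by rw [← Finset.sum_mul, hw, one_mul]
  have herr : ∀ y : Db l n, qhatu ε φ y - qS φ x
      = g / ((1 - e) * S) * ∑ i, (φ i (y i) - m i) := by
    intro y
    have hm : ∑ i, m i
        = ((1 - e) * ∑ i, φ i (x i) + e * ∑ i, ∑ v, φ i v) / g := by
      simp only [m, hmean]
      rw [← Finset.sum_div, Finset.sum_add_distrib, Finset.mul_sum, Finset.mul_sum]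
    rw [Finset.sum_sub_distrib, hm]
    simp only [qhatu, qS, Cphi, ← he_def, ← hg_def, ← hS_def]
    field_simp
    ring
  have hterm : ∀ y : Db l n, pE l ε x y * (qhatu ε φ y - qS φ x) ^ 2
      = (g / ((1 - e) * S)) ^ 2
        * ((∏ i, rowWeight l ε (x i) (y i)) * (∑ i, (φ i (y i) - m i)) ^ 2) := by
    intro y
    rw [herr, pE_eq_prod_rowWeight]
    ring
  simp_rw [hterm]
  rw [← Finset.mul_sum, sum_prod_mul_sum_sq (fun i => rowWeight l ε (x i))
    (fun i v => φ i v - m i) (fun i => hw (x i)) fun i => by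
      simp only [mul_sub, Finset.sum_sub_distrib, ← Finset.sum_mul, hw, one_mul]
      exact sub_self _]
  have hvar : ∀ i, ∑ v, rowWeight l ε (x i) v * (φ i v - m i) ^ 2 ≤ (b - a) ^ 2 := fun i => by
    calc _ ≤ ∑ v, rowWeight l ε (x i) v * (b - a) ^ 2 := by
          refine Finset.sum_le_sum fun v _ => mul_le_mul_of_nonneg_left ?_ (hw0 _ _)
          exact sq_le_sq' (by linarith [ha i v, hmb i]) (by linarith [hb i v, hma i])
      _ = (b - a) ^ 2 := by rw [← Finset.sum_mul, hw, one_mul]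
  have hsum : ∑ i, ∑ v, rowWeight l ε (x i) v * (φ i v - m i) ^ 2 ≤ n * (b - a) ^ 2 := by
    simpa using Finset.sum_le_card_nsmul Finset.univ _ _ fun i _ => hvar i
  calc _ ≤ (g / ((1 - e) * (n * c))) ^ 2 * (n * (b - a) ^ 2) := by
        have hnonneg : 0 ≤ ∑ i, ∑ v, rowWeight l ε (x i) v * (φ i v - m i) ^ 2 :=
          Finset.sum_nonneg fun i _ => Finset.sum_nonneg fun v _ =>
            mul_nonneg (hw0 _ _) (sq_nonneg _)
        gcongr
    _ = _ := by field_simp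

/-- Under the mechanism `E`, the squared-error distortion of the proper companion estimator
`q̂_φ` (a pointwise minimizer over `r ∈ q_φ(D^n)` of `|q̂ᵘ_φ(y) - r|`) satisfies
`E_{Y∼E(x)}[(q̂_φ(Y) - q_φ(x))²] ≤ 4(b-a)²(1+(2^l-1)e^{-ε})²/(c²(1-e^{-ε})² n)`. -/
theorem stmt5 (l n : ℕ) (hl : 1 ≤ l) (hn : 1 ≤ n) (ε : ℝ) (hε : 0 < ε)
    (φ : Fin n → Row l → ℝ) (a b c : ℝ) (hc : 0 < c)
    (hq : ∀ i, a ≤ Amin φ i ∧ Amin φ i < Bmax φ i ∧ Bmax φ i ≤ b ∧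
      c ≤ Bmax φ i - Amin φ i)
    (qhat : Db l n → ℝ)
    (hproper : ∀ y : Db l n, ∃ x0 : Db l n, qhat y = qS φ x0)
    (hmin : ∀ (y : Db l n) (x0 : Db l n), |qhatu ε φ y - qhat y| ≤ |qhatu ε φ y - qS φ x0|)
    (x : Db l n) :
    (∑ y : Db l n, pE l ε x y * (qhat y - qS φ x) ^ 2)
      ≤ 4 * (b - a) ^ 2 * (1 + ((2:ℝ) ^ l - 1) * Real.exp (-ε)) ^ 2
          / (c ^ 2 * (1 - Real.exp (-ε)) ^ 2 * n) := by
  have ha : ∀ i v, a ≤ φ i v := fun i v =>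
    (hq i).1.trans (Finset.inf'_le _ (Finset.mem_univ v))
  have hb : ∀ i v, φ i v ≤ b := fun i v =>
    (Finset.le_sup' (φ i) (Finset.mem_univ v)).trans (hq i).2.2.1
  calc ∑ y : Db l n, pE l ε x y * (qhat y - qS φ x) ^ 2
      ≤ ∑ y : Db l n, 4 * (pE l ε x y * (qhatu ε φ y - qS φ x) ^ 2) := by
        refine Finset.sum_le_sum fun y _ => ?_
        have hp : 0 ≤ pE l ε x y := by
          rw [pE_eq_prod_rowWeight]
          exact Finset.prod_nonneg fun i _ => rowWeight_nonneg l ε _ _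
        have habs : |qhat y - qS φ x| ≤ |2 * (qhatu ε φ y - qS φ x)| := by
          have h1 := abs_sub_le (qhat y) (qhatu ε φ y) (qS φ x)
          rw [abs_sub_comm (qhat y) (qhatu ε φ y)] at h1
          rw [abs_mul, abs_two]
          linarith [hmin y x]
        calc _ ≤ pE l ε x y * (2 * (qhatu ε φ y - qS φ x)) ^ 2 :=
              mul_le_mul_of_nonneg_left (sq_le_sq.2 habs) hp
          _ = _ := by ring
    _ = 4 * ∑ y : Db l n, pE l ε x y * (qhatu ε φ y - qS φ x) ^ 2 := by rw [Finset.mul_sum]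
    _ ≤ _ := mul_le_mul_of_nonneg_left
        (sum_pE_mul_qhatu_sub_sq_le hn hε φ hc ha hb (fun i => (hq i).2.2.2) x) (by norm_num)
    _ = _ := by ring
end

section
/- There exists a universal constant C such that the following holds for every integer l ≥ 1, every integer n ≥ 1 and every real ε > 0. Let X, Y, Z be D^n-valued random variables on a common probability space such that X is uniformly distributed on D^n, Z is uniformly distributed on D^n and independent of (X,Y), and the conditional pmf of Y given X is ε-differentially private, i.e., P(Y=y|X=x) ≤ e^ε·P(Y=y|X=x') for all neighbors x, x' ∈ D^n and all y ∈ D^n. Then E[(E[d(X,Z)|Y,Z] − d(X,Z))²] ≥ (1/4)·max{(1−Φ(1))·σ·γ^{3/2}·√n − C·ρ·γ/σ³, 0}², where γ = 1/(2(1+e^ε/(2^l−1))), σ² = 2^{1−l}, and ρ = 2^{1−l}. -/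
open Finset

/-- Two databases are neighbors if they differ in exactly one row. -/
def Neighbor {l n : ℕ} (x x' : Db l n) : Prop :=
  (Finset.univ.filter fun i => x i ≠ x' i).card = 1

/-- `γ = 1/(2(1+e^ε/(2^l-1)))`. -/
noncomputable def γc (l : ℕ) (ε : ℝ) : ℝ := 1 / (2 * (1 + Real.exp ε / ((2:ℝ) ^ l - 1)))

/-- `σ` with `σ² = 2^{1-l}`. -/
noncomputable def σc (l : ℕ) : ℝ := Real.sqrt ((2:ℝ) ^ (1 - (l : ℤ)))

/-- `ρ = 2^{1-l}`. -/
noncomputable def ρc (l : ℕ) : ℝ := (2:ℝ) ^ (1 - (l : ℤ))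

/-- `Φ(1)`, the standard Gaussian cdf evaluated at `1`. -/
noncomputable def Φ1 : ℝ := ((ProbabilityTheory.gaussianReal 0 1) (Set.Iic 1)).toReal

/-- The conditional expectation `E[d(X,Z) | Y = y, Z = z]` computed from the joint pmf `p`
of `(X, Y, Z)`. -/
noncomputable def condExp3 {l n : ℕ} (p : Db l n → Db l n → Db l n → ℝ) (y z : Db l n) : ℝ :=
  (∑ x, (ham x z : ℝ) * p x y z) / (∑ x, p x y z)

/-- Second moment of a sum of independent centered functions of uniform coordinates. -/
theorem card_mul_sum_sq_of_centered {R : Type*} [Fintype R] (n : ℕ) (f : Fin n → R → ℝ)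
    (hf : ∀ i, ∑ b, f i b = 0) :
    (Fintype.card R : ℝ) * ∑ z : Fin n → R, (∑ i, f i (z i)) ^ 2
      = (Fintype.card R : ℝ) ^ n * ∑ i, ∑ b, f i b ^ 2 := by
  induction n with
  | zero => simp
  | succ n ih =>
    have ih' := ih (fun i => f i.succ) (fun i => hf i.succ)
    rw [← (Fin.consEquiv (fun _ : Fin (n + 1) => R)).sum_comp, Fintype.sum_prod_type]
    simp only [Fin.consEquiv_apply, Fin.sum_univ_succ, Fin.cons_zero, Fin.cons_succ]
    have expand : ∑ b : R, ∑ z : Fin n → R, (f 0 b + ∑ i : Fin n, f i.succ (z i)) ^ 2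
        = (Fintype.card R : ℝ) ^ n * ∑ b, f 0 b ^ 2
          + 2 * (∑ b, f 0 b) * (∑ z : Fin n → R, ∑ i : Fin n, f i.succ (z i))
          + (Fintype.card R : ℝ) * ∑ z : Fin n → R, (∑ i : Fin n, f i.succ (z i)) ^ 2 := by
      simp only [add_sq, sum_add_distrib, ← mul_sum, ← sum_mul, sum_const, card_univ,
        nsmul_eq_mul, Fintype.card_fun, Fintype.card_fin, Nat.cast_pow]
    rw [expand, ih', hf 0]
    ring

theorem ham_cast {l n : ℕ} (x z : Db l n) :
    (ham x z : ℝ) = ∑ i, if x i ≠ z i then (1 : ℝ) else 0 := by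
  rw [sum_boole, ham]

/-- Mean squared difference of the distances of two databases to a uniform one. -/
theorem sum_ham_sub_sq {l n : ℕ} (x x' : Db l n) :
    (2 : ℝ) ^ l * ∑ z, ((ham x z : ℝ) - ham x' z) ^ 2
      = (2 : ℝ) ^ (l * n) * (2 * ham x x') := by
  have h := card_mul_sum_sq_of_centered n
    (fun i b => (if x i ≠ b then (1 : ℝ) else 0) - if x' i ≠ b then (1 : ℝ) else 0)
    (fun i => by simp only [sum_sub_distrib, sum_boole, filter_ne]; simp)
  have hs : ∀ i, ∑ b, ((if x i ≠ b then (1 : ℝ) else 0) - if x' i ≠ b then (1 : ℝ) else 0) ^ 2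
      = 2 * if x i ≠ x' i then (1 : ℝ) else 0 := by
    intro i
    by_cases hx : x i = x' i
    · simp [hx]
    · have hb : ∀ b, ((if x i ≠ b then (1 : ℝ) else 0) - if x' i ≠ b then (1 : ℝ) else 0) ^ 2
          = (if x i = b then (1 : ℝ) else 0) + if x' i = b then (1 : ℝ) else 0 := by
        intro b
        by_cases h1 : x i = b
        · have h2 : x' i ≠ b := fun h2 => hx (h1.trans h2.symm)
          simp [h1, h2]
        · by_cases h2 : x' i = b <;> simp [h1, h2]
      simp only [hb, sum_add_distrib]
      simp [hx]
      norm_num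
  simp only [hs, sum_sub_distrib, ← ham_cast, ← mul_sum] at h
  simpa [pow_mul] using h

theorem weight_coord_eq_le {l n : ℕ} {E : ℝ} (w : Db l n → ℝ)
    (hw : ∀ x x', Neighbor x x' → w x ≤ E * w x') (i : Fin n) {a b : Row l} (hab : a ≠ b) :
    ∑ x with x i = a, w x ≤ E * ∑ x with x i = b, w x := by
  have hbij : ∑ x with x i = b, w x = ∑ x with x i = a, w (Function.update x i b) := by
    refine sum_nbij' (fun x => Function.update x i a) (fun x => Function.update x i b) ?_ ?_ ?_ ?_ ?_
    · simp
    · simp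
    · intro x hx
      have : x i = b := by simpa using hx
      simp [← this]
    · intro x hx
      have : x i = a := by simpa using hx
      simp [← this]
    · intro x hx
      have : x i = b := by simpa using hx
      simp [← this]
  rw [hbij, mul_sum]
  refine sum_le_sum fun x hx => hw _ _ ?_
  have hxa : x i = a := by simpa using hx
  have : (univ.filter fun j => x j ≠ Function.update x i b j) = {i} := by
    ext j
    by_cases hj : j = i
    · subst hj
      simp [hxa, hab]
    · simp [hj]
  rw [Neighbor, this, card_singleton]

theorem weight_le_weight_coord_ne {l n : ℕ} (hl : 1 ≤ l) (ε : ℝ) (w : Db l n → ℝ)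
    (hw : ∀ x x', Neighbor x x' → w x ≤ Real.exp ε * w x') (i : Fin n) (a : Row l) :
    2 * γc l ε * ∑ x, w x ≤ ∑ x with x i ≠ a, w x := by
  have hK : (0 : ℝ) < 2 ^ l - 1 := by
    have : (1 : ℝ) < 2 ^ l := one_lt_pow₀ (by norm_num) (by omega)
    linarith
  have hrest : ∑ b with b ≠ a, ∑ x with x i = b, w x = ∑ x with x i ≠ a, w x := by
    rw [← sum_fiberwise_of_maps_to (s := univ.filter fun x : Db l n => x i ≠ a)
      (t := univ.filter fun b => b ≠ a) (g := fun x => x i) (by simp)]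
    refine sum_congr rfl fun b hb => sum_congr ?_ fun _ _ => rfl
    have hb' : b ≠ a := by simpa using hb
    ext x
    simp only [mem_filter, mem_univ, true_and]
    exact ⟨fun h => ⟨h ▸ hb', h⟩, fun h => h.2⟩
  have hcard : (((univ.filter fun b : Row l => b ≠ a).card : ℕ) : ℝ) = 2 ^ l - 1 := by
    rw [filter_ne' univ a, card_erase_of_mem (mem_univ a), card_univ, Nat.cast_sub]
    · simp
    · exact Fintype.card_pos
  have hmul : (2 ^ l - 1) * ∑ x with x i = a, w x ≤ Real.exp ε * ∑ x with x i ≠ a, w x := by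
    rw [← hrest, ← hcard, ← nsmul_eq_mul, ← sum_const, mul_sum]
    refine sum_le_sum fun b hb => weight_coord_eq_le w hw i ?_
    simpa using (mem_filter.mp hb).2.symm
  rw [← sum_filter_add_sum_filter_not univ (fun x : Db l n => x i = a)]
  have hE := Real.exp_pos ε
  have hγ : 2 * γc l ε = (2 ^ l - 1) / ((2 ^ l - 1) + Real.exp ε) := by
    unfold γc
    field_simp
  rw [hγ, div_mul_eq_mul_div, div_le_iff₀ (by positivity)]
  linarith

/-- The variance identity in terms of two independent copies. -/
theorem sum_mul_sum_mul_sub_mean_sq {α : Type*} [Fintype α] (w f : α → ℝ) (hQ : ∑ x, w x ≠ 0) :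
    2 * (∑ x, w x) * ∑ x, w x * ((∑ x, f x * w x) / (∑ x, w x) - f x) ^ 2
      = ∑ x, ∑ x', w x * w x' * (f x - f x') ^ 2 := by
  have hm : (∑ x, f x * w x) = (∑ x, f x * w x) / (∑ x, w x) * ∑ x, w x := by field_simp
  set m := (∑ x, f x * w x) / (∑ x, w x)
  set Q := ∑ x, w x with hQdef
  have h1 : ∑ x, w x * (m - f x) ^ 2 = ∑ x, w x * f x ^ 2 - m ^ 2 * Q := by
    have : ∀ x, w x * (m - f x) ^ 2 = m ^ 2 * w x - 2 * m * (f x * w x) + w x * f x ^ 2 :=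
      fun x => by ring
    simp only [this, sum_add_distrib, sum_sub_distrib, ← mul_sum, ← hQdef, hm]
    ring
  have h2 : ∑ x, ∑ x', w x * w x' * (f x - f x') ^ 2
      = 2 * Q * ∑ x, w x * f x ^ 2 - 2 * (∑ x, f x * w x) ^ 2 := by
    have : ∀ x x', w x * w x' * (f x - f x') ^ 2
        = w x * f x ^ 2 * w x' - 2 * (f x * w x) * (f x' * w x') + w x * (w x' * f x' ^ 2) :=
      fun x x' => by ring
    simp only [this, sum_add_distrib, sum_sub_distrib, ← mul_sum, ← sum_mul, ← hQdef]
    ring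
  rw [h1, h2, hm]
  ring

theorem sum_variance_ham_ge {l n : ℕ} (hl : 1 ≤ l) (ε : ℝ) (w : Db l n → ℝ)
    (hw0 : ∀ x, 0 ≤ w x) (hw : ∀ x x', Neighbor x x' → w x ≤ Real.exp ε * w x') :
    (2 : ℝ) ^ (l * n) * (2 * γc l ε * n * ∑ x, w x) ≤ (2 : ℝ) ^ l *
      ∑ z, ∑ x, w x * ((∑ x, (ham x z : ℝ) * w x) / (∑ x, w x) - ham x z) ^ 2 := by
  rcases (sum_nonneg fun x (_ : x ∈ univ) => hw0 x).eq_or_lt with hQ | hQ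
  · rw [← hQ, mul_zero, mul_zero]
    exact mul_nonneg (by positivity)
      (sum_nonneg fun z _ => sum_nonneg fun x _ => mul_nonneg (hw0 x) (sq_nonneg _))
  have hpair : 2 * γc l ε * n * (∑ x, w x) * (∑ x, w x)
      ≤ ∑ x, ∑ x', w x * w x' * (ham x x' : ℝ) := by
    have hx : ∀ x, w x * (n * (2 * γc l ε * ∑ x, w x)) ≤ ∑ x', w x * w x' * (ham x x' : ℝ) := by
      intro x
      simp only [mul_assoc (w x)]
      rw [← mul_sum]
      refine mul_le_mul_of_nonneg_left ?_ (hw0 x)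
      have hcoord : ∑ x', w x' * (ham x x' : ℝ) = ∑ i, ∑ x' with x' i ≠ x i, w x' := by
        simp only [ham_cast, mul_sum]
        rw [sum_comm]
        simp [sum_filter, eq_comm]
      calc (n : ℝ) * (2 * γc l ε * ∑ x, w x) = ∑ _i : Fin n, 2 * γc l ε * ∑ x, w x := by simp
        _ ≤ ∑ i, ∑ x' with x' i ≠ x i, w x' :=
            sum_le_sum fun i _ => weight_le_weight_coord_ne hl ε w hw i (x i)
        _ = _ := hcoord.symm
    calc _ = ∑ x, w x * (n * (2 * γc l ε * ∑ x, w x)) := by rw [← sum_mul]; ring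
      _ ≤ _ := sum_le_sum fun x _ => hx x
  have hvar : 2 * (∑ x, w x) * ((2 : ℝ) ^ l *
      ∑ z, ∑ x, w x * ((∑ x, (ham x z : ℝ) * w x) / (∑ x, w x) - ham x z) ^ 2)
      = 2 ^ (l * n) * (2 * ∑ x, ∑ x', w x * w x' * (ham x x' : ℝ)) := by
    rw [mul_left_comm, mul_sum]
    simp only [fun z => sum_mul_sum_mul_sub_mean_sq w (fun x => (ham x z : ℝ)) hQ.ne']
    rw [sum_comm]
    simp only [mul_sum]
    refine sum_congr rfl fun x _ => ?_
    rw [sum_comm]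
    refine sum_congr rfl fun x' _ => ?_
    have h := sum_ham_sub_sq x x'
    simp only [← mul_sum]
    linear_combination (w x * w x') * h
  refine le_of_mul_le_mul_left ?_ (mul_pos two_pos hQ)
  rw [hvar]
  have : (0 : ℝ) < 2 ^ (l * n) := by positivity
  nlinarith [mul_le_mul_of_nonneg_left hpair this.le]

/-- Lower bound `E[(E[d(X,Z)|Y,Z] - d(X,Z))²] ≥ (1/4) max{(1-Φ(1))σγ^{3/2}√n - Cργ/σ³, 0}²`
for `X` uniform, `Z` uniform and independent of `(X,Y)`, and `Y|X` `ε`-differentially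
private; the joint law of `(X,Y,Z)` is described by the pmf `p`. -/
theorem stmt11 :
    ∃ C : ℝ, ∀ (l n : ℕ), 1 ≤ l → 1 ≤ n → ∀ ε : ℝ, 0 < ε →
    ∀ p : Db l n → Db l n → Db l n → ℝ,
      (∀ x y z, 0 ≤ p x y z) →
      (∑ x, ∑ y, ∑ z, p x y z = 1) →
      -- `X` is uniformly distributed on `D^n`
      (∀ x, ∑ y, ∑ z, p x y z = ((2:ℝ) ^ (l * n))⁻¹) →
      -- `Z` is uniformly distributed and independent of `(X, Y)`
      (∀ x y z, p x y z = (∑ z', p x y z') * ((2:ℝ) ^ (l * n))⁻¹) →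
      -- the conditional pmf of `Y` given `X` is `ε`-differentially private
      (∀ x x', Neighbor x x' → ∀ y, (∑ z, p x y z) ≤ Real.exp ε * ∑ z, p x' y z) →
      (1 / 4) *
          (max ((1 - Φ1) * σc l * γc l ε ^ ((3:ℝ)/2) * Real.sqrt n
                - C * ρc l * γc l ε / (σc l) ^ 3) 0) ^ 2
        ≤ ∑ x, ∑ y, ∑ z, p x y z * (condExp3 p y z - (ham x z : ℝ)) ^ 2 := by
  refine ⟨0, fun l n hl _ ε _ p hp0 hp1 _ hind hdp => ?_⟩
  have hK : (0 : ℝ) < 2 ^ l - 1 := by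
    have : (1 : ℝ) < 2 ^ l := one_lt_pow₀ (by norm_num) (by omega)
    linarith
  have hN : (0 : ℝ) < 2 ^ (l * n) := by positivity
  have hγ0 : 0 < γc l ε := by unfold γc; positivity
  have hγ1 : γc l ε ≤ 1 := by
    unfold γc
    rw [div_le_one (by positivity)]
    have : 0 < Real.exp ε / ((2 : ℝ) ^ l - 1) := by positivity
    linarith
  have hΦ0 : 0 ≤ Φ1 := ENNReal.toReal_nonneg
  have hΦ1 : Φ1 ≤ 1 := ENNReal.toReal_le_of_le_ofReal zero_le_one (by simpa using MeasureTheory.prob_le_one)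
  have hσ : σc l ^ 2 = 2 / 2 ^ l := by
    rw [σc, Real.sq_sqrt (by positivity), zpow_sub₀ two_ne_zero]
    simp
  have hlhs : (1 / 4) * (max ((1 - Φ1) * σc l * γc l ε ^ ((3:ℝ)/2) * Real.sqrt n
      - 0 * ρc l * γc l ε / (σc l) ^ 3) 0) ^ 2 ≤ 2 * γc l ε * n / 2 ^ l := by
    have hnn : 0 ≤ (1 - Φ1) * σc l * γc l ε ^ ((3:ℝ)/2) * Real.sqrt n := by
      have : 0 ≤ 1 - Φ1 := by linarith
      have : 0 ≤ σc l := Real.sqrt_nonneg _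
      positivity
    have hγ3 : (γc l ε ^ ((3:ℝ)/2)) ^ 2 = γc l ε ^ 3 := by
      rw [← Real.rpow_natCast, ← Real.rpow_mul hγ0.le, ← Real.rpow_natCast]
      norm_num
    rw [zero_mul, zero_mul, zero_div, sub_zero, max_eq_left hnn, mul_pow, mul_pow, mul_pow, hγ3,
      Real.sq_sqrt (Nat.cast_nonneg n), hσ]
    have h1 : (1 - Φ1) ^ 2 ≤ 1 := pow_le_one₀ (by linarith) (by linarith)
    have h2 : γc l ε ^ 3 ≤ γc l ε := pow_le_of_le_one hγ0.le hγ1 (by norm_num)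
    calc 1 / 4 * ((1 - Φ1) ^ 2 * (2 / 2 ^ l) * γc l ε ^ 3 * n)
        ≤ 1 * (1 * (2 / 2 ^ l) * γc l ε * n) := by gcongr; norm_num
      _ = _ := by ring
  refine hlhs.trans ?_
  have hcond : ∀ y z, condExp3 p y z
      = (∑ x, (ham x z : ℝ) * ∑ z', p x y z') / (∑ x, ∑ z', p x y z') := by
    intro y z
    have h1 : ∑ x, (ham x z : ℝ) * p x y z
        = (∑ x, (ham x z : ℝ) * ∑ z', p x y z') * ((2:ℝ) ^ (l * n))⁻¹ := by
      rw [sum_mul]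
      exact sum_congr rfl fun x _ => by rw [hind x y z, mul_assoc]
    have h2 : ∑ x, p x y z = (∑ x, ∑ z', p x y z') * ((2:ℝ) ^ (l * n))⁻¹ := by
      rw [sum_mul]
      exact sum_congr rfl fun x _ => hind x y z
    rw [condExp3, h1, h2, mul_div_mul_right _ _ (inv_ne_zero hN.ne')]
  have hy : ∀ y, 2 * γc l ε * n / 2 ^ l * ∑ x, ∑ z, p x y z
      ≤ ∑ x, ∑ z, p x y z * (condExp3 p y z - (ham x z : ℝ)) ^ 2 := by
    intro y
    have h := sum_variance_ham_ge hl ε (fun x => ∑ z, p x y z)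
      (fun x => sum_nonneg fun z _ => hp0 x y z) (fun x x' hx => hdp x x' hx y)
    have hre : ∑ x, ∑ z, p x y z * (condExp3 p y z - (ham x z : ℝ)) ^ 2
        = ((2:ℝ) ^ (l * n))⁻¹ * ∑ z, ∑ x, (∑ z', p x y z') *
          ((∑ x, (ham x z : ℝ) * ∑ z', p x y z') / (∑ x, ∑ z', p x y z') - ham x z) ^ 2 := by
      rw [sum_comm]
      simp only [mul_sum (s := univ (α := Db l n)) (a := ((2:ℝ) ^ (l * n))⁻¹)]
      refine sum_congr rfl fun z _ => sum_congr rfl fun x _ => ?_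
      rw [← hcond, hind x y z]
      ring
    rw [hre, div_mul_eq_mul_div, div_le_iff₀ (by positivity), inv_mul_eq_div, div_mul_eq_mul_div,
      le_div_iff₀ hN]
    linarith
  calc 2 * γc l ε * n / 2 ^ l
      = ∑ y, 2 * γc l ε * n / 2 ^ l * ∑ x, ∑ z, p x y z := by
        rw [← mul_sum, sum_comm, hp1, mul_one]
    _ ≤ ∑ y, ∑ x, ∑ z, p x y z * (condExp3 p y z - (ham x z : ℝ)) ^ 2 := sum_le_sum fun y _ => hy y
    _ = _ := sum_comm
end
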